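/- In the finite missing-data model with smooth parametrization, fix θ0 ∈ Θ, and for δ > 0 small enough that (θ0 − δ, θ0 + δ) ⊆ Θ, let π_δ be the uniform distribution on (θ0 − δ, θ0 + δ). Let V₁(δ) be the variance of θ ↦ lod(θ,θ0|y) under the posterior p(dθ|y) built from π_δ, and V₂(δ) the variance of (θ,ω) ↦ log( f(ω|y,θ) / f(ω|y,θ0) ) under the joint posterior p(dθ|y) f(ω|y,θ) on Θ × Ω_y, and define BI₂^{π_δ} = V₁(δ) / (V₁(δ) + V₂(δ)). Let S = ℓ_ob'(θ0) and I_mi = Σ_{ω∈Ω_y} f(ω|y,θ0) (∂/∂θ log f(ω|y,θ)|_{θ=θ0})², and assume S² + I_mi > 0. Then for all sufficiently small δ > 0 the quantity V₁(δ) + V₂(δ) is positive, and lim_{δ→0⁺} BI₂^{π_δ} = S² / (S² + I_mi). -/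

import Mathlib

open Topology Filter MeasureTheory


lemma aux_int (n : ℕ) (Θ : Set ℝ) (hΘ : IsOpen Θ) (θ0 : ℝ) (h0 : θ0 ∈ Θ) (q : ℝ → ℝ)
    (hq : ContinuousOn q Θ) :
    Tendsto (fun δ => (∫ θ in Set.Ioo (θ0 - δ) (θ0 + δ), q θ * (θ - θ0) ^ n) / δ ^ (n + 1))
      (𝓝[>] (0 : ℝ)) (𝓝 (q θ0 * ((1 - (-1) ^ (n + 1)) / (n + 1)))) := by
  rw [Metric.tendsto_nhds]
  intro ε hε
  obtain ⟨r, hr, hball⟩ := Metric.isOpen_iff.1 hΘ θ0 h0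
  obtain ⟨s, hs, hqs⟩ := Metric.continuousAt_iff.1 (hq.continuousAt (hΘ.mem_nhds h0)) (ε / 4)
    (by positivity)
  have hm : Set.Ioo (0 : ℝ) (min r s) ∈ 𝓝[>] (0 : ℝ) := Ioo_mem_nhdsGT (lt_min hr hs)
  filter_upwards [hm] with δ hδ
  obtain ⟨hδ0, hδ1⟩ := hδ
  have hδr := hδ1.trans_le (min_le_left _ _)
  have hδs := hδ1.trans_le (min_le_right _ _)
  have hle : θ0 - δ ≤ θ0 + δ := by linarith
  have hsub : Set.Icc (θ0 - δ) (θ0 + δ) ⊆ Θ := by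
    intro x hx
    apply hball
    rw [Metric.mem_ball, Real.dist_eq, abs_lt]
    constructor <;> linarith [hx.1, hx.2]
  have hint1 : IntegrableOn (fun θ => q θ * (θ - θ0) ^ n) (Set.Ioo (θ0 - δ) (θ0 + δ)) := by
    refine (ContinuousOn.integrableOn_Icc ?_).mono_set Set.Ioo_subset_Icc_self
    exact (hq.mono hsub).mul (by fun_prop)
  have hint2 : IntegrableOn (fun θ => q θ0 * (θ - θ0) ^ n) (Set.Ioo (θ0 - δ) (θ0 + δ)) := by
    refine (ContinuousOn.integrableOn_Icc ?_).mono_set Set.Ioo_subset_Icc_self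
    fun_prop
  have hexact : ∫ θ in Set.Ioo (θ0 - δ) (θ0 + δ), q θ0 * (θ - θ0) ^ n
      = q θ0 * ((1 - (-1) ^ (n + 1)) / (n + 1)) * δ ^ (n + 1) := by
    rw [← integral_Ioc_eq_integral_Ioo, ← intervalIntegral.integral_of_le hle,
      intervalIntegral.integral_const_mul,
      intervalIntegral.integral_comp_sub_right (fun x => x ^ n) θ0, integral_pow]
    have e1 : θ0 + δ - θ0 = δ := by ring
    have e2 : θ0 - δ - θ0 = (-1) * δ := by ring
    rw [e1, e2, mul_pow]
    ring
  have hbound : ‖∫ θ in Set.Ioo (θ0 - δ) (θ0 + δ),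
      (q θ * (θ - θ0) ^ n - q θ0 * (θ - θ0) ^ n)‖ ≤ (ε / 4 * δ ^ n) * (2 * δ) := by
    have := norm_setIntegral_le_of_norm_le_const (μ := volume) (C := ε / 4 * δ ^ n)
      (f := fun θ => q θ * (θ - θ0) ^ n - q θ0 * (θ - θ0) ^ n)
      (s := Set.Ioo (θ0 - δ) (θ0 + δ)) (by simp) (by
        intro x hx
        have hx' : |x - θ0| < δ := by
          rw [abs_lt]; constructor <;> linarith [hx.1, hx.2]
        rw [← sub_mul, norm_mul, norm_pow, Real.norm_eq_abs, Real.norm_eq_abs]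
        have h1 : |q x - q θ0| ≤ ε / 4 := by
          rw [← Real.dist_eq]
          exact (hqs (by rw [Real.dist_eq]; linarith)).le
        gcongr)
    refine this.trans (le_of_eq ?_)
    rw [Real.volume_real_Ioo_of_le hle]
    ring
  rw [integral_sub hint1 hint2, hexact, Real.norm_eq_abs] at hbound
  have hp : 0 < δ ^ (n + 1) := by positivity
  rw [Real.dist_eq]
  have : ∀ I : ℝ, I / δ ^ (n + 1) - q θ0 * ((1 - (-1) ^ (n + 1)) / (n + 1))
      = (I - q θ0 * ((1 - (-1) ^ (n + 1)) / (n + 1)) * δ ^ (n + 1)) / δ ^ (n + 1) := by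
    intro I; field_simp
  rw [this, abs_div, abs_of_pos hp, div_lt_iff₀ hp]
  refine hbound.trans_lt ?_
  have : (ε / 4 * δ ^ n) * (2 * δ) = ε / 2 * δ ^ (n + 1) := by ring
  rw [this]
  gcongr
  linarith

lemma aux_sum {Ω : Type*} (n : ℕ) (T : Finset Ω) (Θ : Set ℝ) (hΘ : IsOpen Θ) (θ0 : ℝ)
    (h0 : θ0 ∈ Θ) (w h : ℝ → Ω → ℝ) (hw : ∀ ω, ContinuousOn (fun θ => w θ ω) Θ)
    (hh : ∀ ω ∈ T, DifferentiableOn ℝ (fun θ => h θ ω) Θ) :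
    Tendsto (fun δ => (∫ θ in Set.Ioo (θ0 - δ) (θ0 + δ),
        ∑ ω ∈ T, w θ ω * (h θ ω - h θ0 ω) ^ n) / δ ^ (n + 1))
      (𝓝[>] (0 : ℝ)) (𝓝 ((∑ ω ∈ T, w θ0 ω * (deriv (fun θ => h θ ω) θ0) ^ n) *
        ((1 - (-1) ^ (n + 1)) / (n + 1)))) := by
  have := aux_int n Θ hΘ θ0 h0
    (fun θ => ∑ ω ∈ T, w θ ω * (dslope (fun θ => h θ ω) θ0 θ) ^ n) (by
      refine continuousOn_finsetSum _ fun ω hω => (hw ω).mul (ContinuousOn.pow ?_ n)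
      rw [continuousOn_dslope (hΘ.mem_nhds h0)]
      exact ⟨(hh ω hω).continuousOn, (hh ω hω).differentiableAt (hΘ.mem_nhds h0)⟩)
  simp only [dslope_same] at this
  convert this using 5 with δ θ
  rw [Finset.sum_mul]
  refine Finset.sum_congr rfl fun ω _ => ?_
  rw [mul_assoc, ← mul_pow]
  have := sub_smul_dslope (fun θ => h θ ω) θ0 θ
  simp only [smul_eq_mul] at this
  rw [← this]
  ring

/-- Proposition 1, case k = 2: in the finite missing-data model with smooth
parametrization, let `π_δ` be uniform on `(θ0−δ, θ0+δ)`, `V₁(δ)` the posterior variance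
of `θ ↦ lod(θ,θ0|y)`, `V₂(δ)` the joint-posterior variance of
`(θ,ω) ↦ log(f(ω|y,θ)/f(ω|y,θ0))`, and `BI₂^{π_δ} = V₁/(V₁+V₂)`.  With `S = ℓ_ob'(θ0)`,
`I_mi = ∑_{ω∈Ωy} f(ω|y,θ0)(∂ log f(ω|y,θ)/∂θ|_{θ0})²` and `S² + I_mi > 0`, the quantity
`V₁(δ)+V₂(δ)` is eventually positive as `δ → 0⁺` and `BI₂^{π_δ} → S²/(S² + I_mi)`. -/
theorem stmt_3 {Ω O : Type*} [Fintype Ω]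
    (g : Ω → O) (y : O) (Ωy : Finset Ω) (hΩy : ∀ ω, ω ∈ Ωy ↔ g ω = y)
    (hne : Ωy.Nonempty)
    (Θ : Set ℝ) (hΘopen : IsOpen Θ) (hΘconn : Θ.OrdConnected)
    (f : ℝ → Ω → ℝ)
    (hpos : ∀ θ ∈ Θ, ∀ ω, 0 < f θ ω)
    (hsum : ∀ θ ∈ Θ, ∑ ω, f θ ω = 1)
    (hsmooth : ∀ ω, ContDiffOn ℝ (⊤ : ℕ∞) (fun θ => f θ ω) Θ)
    (θ0 : ℝ) (hθ0 : θ0 ∈ Θ)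
    (fob : ℝ → ℝ) (hfob : ∀ θ, fob θ = ∑ ω ∈ Ωy, f θ ω)
    (fcond : ℝ → Ω → ℝ) (hfcond : ∀ θ ω, fcond θ ω = f θ ω / fob θ)
    (S : ℝ) (hS : S = deriv (fun θ => Real.log (fob θ)) θ0)
    (Imi : ℝ)
    (hImi : Imi = ∑ ω ∈ Ωy, fcond θ0 ω * (deriv (fun θ => Real.log (fcond θ ω)) θ0) ^ 2)
    (hpos2 : 0 < S ^ 2 + Imi)
    -- posterior expectation under the uniform prior on (θ0−δ, θ0+δ)
    (Epost : ℝ → (ℝ → ℝ) → ℝ)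
    (hEpost : ∀ δ h, Epost δ h =
      (∫ θ in Set.Ioo (θ0 - δ) (θ0 + δ), fob θ * h θ) /
        (∫ θ in Set.Ioo (θ0 - δ) (θ0 + δ), fob θ))
    -- joint-posterior expectation under the uniform prior on (θ0−δ, θ0+δ)
    (Ejoint : ℝ → (ℝ → Ω → ℝ) → ℝ)
    (hEjoint : ∀ δ h, Ejoint δ h =
      (∫ θ in Set.Ioo (θ0 - δ) (θ0 + δ), ∑ ω ∈ Ωy, f θ ω * h θ ω) /
        (∫ θ in Set.Ioo (θ0 - δ) (θ0 + δ), fob θ))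
    -- V₁: posterior variance of the observed-data lod; V₂: joint-posterior variance of
    -- the log-ratio of conditional densities
    (V₁ V₂ : ℝ → ℝ)
    (hV₁ : ∀ δ, V₁ δ =
      Epost δ (fun θ => (Real.log (fob θ) - Real.log (fob θ0)) ^ 2) -
        (Epost δ (fun θ => Real.log (fob θ) - Real.log (fob θ0))) ^ 2)
    (hV₂ : ∀ δ, V₂ δ =
      Ejoint δ (fun θ ω => (Real.log (fcond θ ω) - Real.log (fcond θ0 ω)) ^ 2) -
        (Ejoint δ (fun θ ω => Real.log (fcond θ ω) - Real.log (fcond θ0 ω))) ^ 2) :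
    (∀ᶠ δ in 𝓝[>] (0 : ℝ), 0 < V₁ δ + V₂ δ) ∧
    Tendsto (fun δ => V₁ δ / (V₁ δ + V₂ δ)) (𝓝[>] (0 : ℝ))
      (𝓝 (S ^ 2 / (S ^ 2 + Imi))) := by
  have hfs : ∀ ω, DifferentiableOn ℝ (fun θ => f θ ω) Θ := fun ω =>
    (hsmooth ω).differentiableOn (by simp)
  have hfobpos : ∀ θ ∈ Θ, 0 < fob θ := fun θ hθ => by
    rw [hfob]; exact Finset.sum_pos (fun ω _ => hpos θ hθ ω) hne
  have hfobd : DifferentiableOn ℝ fob Θ := by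
    rw [funext hfob]
    exact DifferentiableOn.fun_sum fun ω _ => hfs ω
  have hlog : DifferentiableOn ℝ (fun θ => Real.log (fob θ)) Θ :=
    hfobd.log fun θ hθ => (hfobpos θ hθ).ne'
  have hclog : ∀ ω, DifferentiableOn ℝ (fun θ => Real.log (fcond θ ω)) Θ := fun ω => by
    simp only [hfcond]
    exact ((hfs ω).div hfobd fun θ hθ => (hfobpos θ hθ).ne').log
      fun θ hθ => (div_pos (hpos θ hθ ω) (hfobpos θ hθ)).ne'
  have hF := hfobpos θ0 hθ0
  -- denominators
  have hD := aux_int 0 Θ hΘopen θ0 hθ0 fob hfobd.continuousOn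
  have hA1 := aux_sum 2 (Finset.univ : Finset Unit) Θ hΘopen θ0 hθ0 (fun θ _ => fob θ)
    (fun θ _ => Real.log (fob θ)) (fun _ => hfobd.continuousOn) (fun _ _ => hlog)
  have hB1 := aux_sum 1 (Finset.univ : Finset Unit) Θ hΘopen θ0 hθ0 (fun θ _ => fob θ)
    (fun θ _ => Real.log (fob θ)) (fun _ => hfobd.continuousOn) (fun _ _ => hlog)
  have hA2 := aux_sum 2 Ωy Θ hΘopen θ0 hθ0 f
    (fun θ ω => Real.log (fcond θ ω)) (fun ω => (hfs ω).continuousOn) (fun ω _ => hclog ω)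
  have hB2 := aux_sum 1 Ωy Θ hΘopen θ0 hθ0 f
    (fun θ ω => Real.log (fcond θ ω)) (fun ω => (hfs ω).continuousOn) (fun ω _ => hclog ω)
  have hFI : ∑ ω ∈ Ωy, f θ0 ω * (deriv (fun θ => Real.log (fcond θ ω)) θ0) ^ 2
      = fob θ0 * Imi := by
    rw [hImi, Finset.mul_sum]
    refine Finset.sum_congr rfl fun ω _ => ?_
    rw [hfcond θ0 ω]
    field_simp
  rw [hFI] at hA2
  simp only [Finset.univ_unique, Finset.sum_singleton, ← hS] at hA1 hB1
  simp only [pow_one, pow_zero, mul_one, zero_add] at hD hB1 hB2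
  norm_num at hD hA1 hB1 hA2 hB2
  have hDne : fob θ0 * 2 ≠ 0 := by positivity
  have key : ∀ A B D : ℝ → ℝ, ∀ c : ℝ,
      Tendsto (fun δ => D δ / δ) (𝓝[>] (0 : ℝ)) (𝓝 (fob θ0 * 2)) →
      Tendsto (fun δ => A δ / δ ^ 3) (𝓝[>] (0 : ℝ)) (𝓝 (fob θ0 * c * (2 / 3))) →
      Tendsto (fun δ => B δ / δ ^ 2) (𝓝[>] (0 : ℝ)) (𝓝 0) →
      Tendsto (fun δ => (A δ / D δ - (B δ / D δ) ^ 2) / δ ^ 2) (𝓝[>] (0 : ℝ)) (𝓝 (c / 3)) := by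
    intro A B D c hD hA hB
    have := (hA.div hD hDne).sub ((hB.div hD hDne).pow 2)
    have e : fob θ0 * c * (2 / 3) / (fob θ0 * 2) - (0 / (fob θ0 * 2)) ^ 2 = c / 3 := by
      field_simp
      ring
    rw [e] at this
    refine this.congr' ?_
    filter_upwards [self_mem_nhdsWithin] with δ hδ
    have hδ : δ ≠ 0 := (Set.mem_Ioi.1 hδ).ne'
    rcases eq_or_ne (D δ) 0 with h | h
    · simp [h]
    · simp only [Pi.div_apply]
      field_simp
  have hV1 : Tendsto (fun δ => V₁ δ / δ ^ 2) (𝓝[>] (0 : ℝ)) (𝓝 (S ^ 2 / 3)) := by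
    simp only [hV₁, hEpost]
    exact key _ _ _ _ hD hA1 hB1
  have hV2 : Tendsto (fun δ => V₂ δ / δ ^ 2) (𝓝[>] (0 : ℝ)) (𝓝 (Imi / 3)) := by
    simp only [hV₂, hEjoint]
    exact key _ _ _ _ hD hA2 hB2
  have hsumV := hV1.add hV2
  have hpos3 : 0 < S ^ 2 / 3 + Imi / 3 := by linarith
  constructor
  · filter_upwards [hsumV.eventually (lt_mem_nhds hpos3), self_mem_nhdsWithin] with δ h hδ
    have hδ : 0 < δ := hδ
    rw [← add_div] at h
    exact (div_pos_iff_of_pos_right (by positivity)).1 h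
  · have := hV1.div hsumV hpos3.ne'
    have e : S ^ 2 / 3 / (S ^ 2 / 3 + Imi / 3) = S ^ 2 / (S ^ 2 + Imi) := by
      rw [← add_div, div_div_div_cancel_right₀ (by norm_num)]
    rw [e] at this
    refine this.congr' ?_
    filter_upwards [self_mem_nhdsWithin] with δ hδ
    have hδ : δ ^ 2 ≠ 0 := pow_ne_zero 2 (Set.mem_Ioi.1 hδ).ne'
    simp only [Pi.div_apply]
    rw [← add_div, div_div_div_cancel_right₀ hδ]
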